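/- Let n > 4 be an integer and G a group of order 2^n that is not cyclic. Then β(G) ≥ β(Z_2 × Z_{2^{n-1}}) = β(M(2^n)) = (3(n-1)+2)/2^n, and equality holds if and only if G is isomorphic to Z_2 × Z_{2^{n-1}} or to M(2^n). -/

import Mathlib

noncomputable def beta (G : Type*) [Group G] : ℝ :=
  (Nat.card (Subgroup G) : ℝ) / (Nat.card G : ℝ)

/-- Relations of the modular `p`-group `M(p^n)`:
`x^(p^(n-1)) = 1`, `y^p = 1`, `y⁻¹ x y = x^(1 + p^(n-2))`. -/
def modularRels (p n : ℕ) : Set (FreeGroup (Fin 2)) :=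
  { FreeGroup.of 0 ^ (p ^ (n - 1)),
    FreeGroup.of 1 ^ p,
    (FreeGroup.of 1)⁻¹ * FreeGroup.of 0 * FreeGroup.of 1 *
      (FreeGroup.of 0 ^ (1 + p ^ (n - 2)))⁻¹ }

/-- The modular `p`-group `M(p^n)` given by its presentation. -/
def ModularGroup (p n : ℕ) : Type := PresentedGroup (modularRels p n)

instance (p n : ℕ) : Group (ModularGroup p n) := by
  unfold ModularGroup; infer_instance

open Subgroup

section Extension

variable {G : Type*} [Group G]

lemma mem_zpowers_zpow_of_odd {b : G} {m : ℕ} (hb : b ^ 2 ^ m = 1) {q : ℤ} (hq : Odd q) :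
    b ∈ zpowers (b ^ q) := by
  have hco : IsCoprime q ((2 : ℤ) ^ m) := (Int.isCoprime_two_right.2 hq).pow_right
  obtain ⟨u, v, huv⟩ := hco
  have hb' : b ^ ((2 : ℤ) ^ m) = 1 := by exact_mod_cast hb
  refine mem_zpowers_iff.2 ⟨u, ?_⟩
  calc (b ^ q) ^ u = b ^ (u * q) * (b ^ ((2 : ℤ) ^ m)) ^ v := by
        rw [hb', one_zpow, mul_one, ← zpow_mul, mul_comm]
    _ = b ^ (u * q + v * 2 ^ m) := by rw [← zpow_mul, ← zpow_add, mul_comm v]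
    _ = b := by rw [huv, zpow_one]

lemma mul_zpow_eq_of_conj {a t : G} {r : ℤ} (ht : t * t = 1) (hat : t * a * t = a ^ r) (i : ℤ) :
    t * a ^ i = a ^ (r * i) * t := by
  have hinv : t⁻¹ = t := inv_eq_of_mul_eq_one_left ht
  have h : t * a ^ i * t⁻¹ = a ^ (r * i) := by
    rw [← conj_zpow, hinv, hat, zpow_mul]
  rw [← h, inv_mul_cancel_right]

lemma exists_zpow_of_mem_closure_pair {a t : G} {r : ℤ} (ht : t * t = 1)
    (hat : t * a * t = a ^ r) {x : G} (hx : x ∈ closure {a, t}) :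
    ∃ i : ℤ, x = a ^ i ∨ x = a ^ i * t := by
  have hinv : t⁻¹ = t := inv_eq_of_mul_eq_one_left ht
  have hc := mul_zpow_eq_of_conj ht hat
  induction hx using closure_induction with
  | mem x hx =>
    rcases hx with rfl | rfl
    · exact ⟨1, Or.inl (zpow_one _).symm⟩
    · exact ⟨0, Or.inr (by simp)⟩
  | one => exact ⟨0, Or.inl (by simp)⟩
  | mul x y _ _ hx hy =>
    obtain ⟨i, rfl | rfl⟩ := hx <;> obtain ⟨j, rfl | rfl⟩ := hy
    · exact ⟨i + j, Or.inl (zpow_add _ _ _).symm⟩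
    · exact ⟨i + j, Or.inr (by rw [zpow_add, mul_assoc])⟩
    · exact ⟨i + r * j, Or.inr (by rw [mul_assoc, hc, zpow_add, mul_assoc])⟩
    · refine ⟨i + r * j, Or.inl ?_⟩
      rw [mul_assoc, ← mul_assoc t, hc, mul_assoc _ t t, ht, mul_one, zpow_add]
  | inv x _ hx =>
    obtain ⟨i, rfl | rfl⟩ := hx
    · exact ⟨-i, Or.inl (zpow_neg _ _).symm⟩
    · exact ⟨r * -i, Or.inr (by rw [mul_inv_rev, hinv, ← zpow_neg, hc])⟩

/-- A subgroup of `⟨a, t⟩` not contained in `⟨a ^ 2, t⟩` is `⟨a, t⟩`, `⟨a⟩` or `⟨a ^ 2, a t⟩`. -/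
lemma eq_of_le_closure_pair_of_not_le {a t : G} {m : ℕ} {k : ℤ} (ht : t * t = 1)
    (ha : a ^ 2 ^ m = 1) (hat : t * a * t = a ^ (1 + 4 * k)) {H : Subgroup G}
    (hH : H ≤ closure {a, t}) (hH' : ¬ H ≤ closure {a ^ 2, t}) :
    H = closure {a, t} ∨ H = zpowers a ∨ H = closure {a ^ 2, a * t} := by
  have hform := fun x (hx : x ∈ H) => exists_zpow_of_mem_closure_pair ht hat (hH hx)
  have ha2 : (a ^ 2) ^ 2 ^ m = 1 := by rw [← pow_mul, mul_comm, pow_mul, ha, one_pow]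
  have heven : ∀ {K : Subgroup G}, a ^ 2 ∈ K → ∀ j : ℤ, a ^ (2 * j) ∈ K := fun {K} h j => by
    rw [zpow_mul]; exact K.zpow_mem (by exact_mod_cast h) j
  obtain ⟨g, hgH, hg⟩ := SetLike.not_le_iff_exists.1 hH'
  have ha2c : a ^ 2 ∈ closure {a ^ 2, t} := subset_closure (by simp)
  have htc : t ∈ closure {a ^ 2, t} := subset_closure (by simp)
  have hodd : ∃ i : ℤ, Odd i ∧ (g = a ^ i ∨ g = a ^ i * t) := by
    obtain ⟨i, hi⟩ := hform g hgH
    refine ⟨i, ?_, hi⟩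
    rw [← Int.not_even_iff_odd, even_iff_exists_two_mul]
    rintro ⟨j, rfl⟩
    rcases hi with rfl | rfl
    · exact hg (heven ha2c j)
    · exact hg (mul_mem (heven ha2c j) htc)
  obtain ⟨i, hi, hgi⟩ := hodd
  have ha2H : a ^ 2 ∈ H := by
    have hsq : ∃ q : ℤ, Odd q ∧ g ^ 2 = (a ^ 2) ^ q := by
      rcases hgi with rfl | rfl
      · exact ⟨i, hi, by rw [← zpow_natCast, ← zpow_natCast, ← zpow_mul, ← zpow_mul, mul_comm]⟩
      · refine ⟨i * (1 + 2 * k), hi.mul ⟨k, by ring⟩, ?_⟩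
        rw [pow_two, mul_assoc, ← mul_assoc t, mul_zpow_eq_of_conj ht hat, mul_assoc _ t t, ht,
          mul_one, ← zpow_add, ← zpow_natCast, ← zpow_mul]
        congr 1
        push_cast
        ring
    obtain ⟨q, hq, hgq⟩ := hsq
    have := mem_zpowers_zpow_of_odd ha2 hq
    rw [← hgq] at this
    exact (zpowers_le.2 (H.pow_mem hgH 2)) this
  have haH : ∀ {j : ℤ}, Odd j → a ^ j ∈ H → a ∈ H := by
    rintro j ⟨l, rfl⟩ hj
    rw [zpow_add, zpow_one] at hj
    exact (H.mul_mem_cancel_left (heven ha2H l)).1 hj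
  have hatH : ∀ {j : ℤ}, Odd j → a ^ j * t ∈ H → a * t ∈ H := by
    rintro j ⟨l, rfl⟩ hj
    rw [zpow_add, zpow_one, mul_assoc] at hj
    exact (H.mul_mem_cancel_left (heven ha2H l)).1 hj
  by_cases haM : a ∈ H
  · by_cases htM : t ∈ H
    · left
      refine le_antisymm hH ((closure_le _).2 ?_)
      rintro x (rfl | rfl) <;> assumption
    · right; left
      refine le_antisymm (fun x hx => ?_) (zpowers_le.2 haM)
      obtain ⟨j, rfl | rfl⟩ := hform x hx
      · exact zpow_mem (mem_zpowers a) j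
      · exact absurd ((H.mul_mem_cancel_left (zpow_mem haM j)).1 hx) htM
  · right; right
    have hat' : a * t ∈ H := by
      rcases hgi with rfl | rfl
      · exact absurd (haH hi hgH) haM
      · exact hatH hi hgH
    have htM : t ∉ H := fun h => haM ((H.mul_mem_cancel_right h).1 hat')
    have h1 : a ^ 2 ∈ closure {a ^ 2, a * t} := subset_closure (by simp)
    have h2 : a * t ∈ closure {a ^ 2, a * t} := subset_closure (by simp)
    refine le_antisymm (fun x hx => ?_) ((closure_le _).2 ?_)
    · obtain ⟨j, hj⟩ := hform x hx
      rcases Int.even_or_odd' j with ⟨l, rfl | rfl⟩ <;> rcases hj with rfl | rfl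
      · exact heven h1 l
      · exact absurd ((H.mul_mem_cancel_left (heven ha2H l)).1 hx) htM
      · exact absurd (haH ⟨l, rfl⟩ hx) haM
      · rw [zpow_add, zpow_one, mul_assoc]
        exact mul_mem (heven h1 l) h2
    · rintro x (rfl | rfl) <;> assumption

lemma ncard_le_closure_pair [Finite G] {t : G} {k : ℤ} (ht : t * t = 1) :
    ∀ (m : ℕ) (a : G), a ^ 2 ^ m = 1 → t * a * t = a ^ (1 + 4 * k) →
      {H : Subgroup G | H ≤ closure {a, t}}.ncard ≤ 3 * m + 2
  | 0, a, ha, hat => by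
    obtain rfl : a = 1 := by simpa using ha
    have hsub : {H : Subgroup G | H ≤ closure {1, t}} ⊆ {⊥, closure {1, t}} := by
      intro H hH
      by_cases htH : t ∈ H
      · right
        refine le_antisymm hH ((closure_le _).2 ?_)
        rintro x (rfl | rfl)
        exacts [H.one_mem, htH]
      · left
        refine (eq_bot_iff_forall H).2 fun x hx => ?_
        obtain ⟨j, rfl | rfl⟩ := exists_zpow_of_mem_closure_pair ht hat (hH hx)
        · simp
        · exact absurd (by simpa using hx) htH
    exact (Set.ncard_le_ncard hsub).trans ((Set.ncard_insert_le _ _).trans (by simp))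
  | m + 1, a, ha, hat => by
    have ha2 : (a ^ 2) ^ 2 ^ m = 1 := by rw [← pow_mul, ← pow_succ', ha]
    have hat2 : t * a ^ 2 * t = (a ^ 2) ^ (1 + 4 * k) := by
      rw [← zpow_natCast a, mul_zpow_eq_of_conj ht hat, mul_assoc, ht, mul_one, ← zpow_mul,
        mul_comm]
    have hsub : {H : Subgroup G | H ≤ closure {a, t}} ⊆
        {H : Subgroup G | H ≤ closure {a ^ 2, t}} ∪
          {closure {a, t}, zpowers a, closure {a ^ 2, a * t}} := by
      intro H hH
      by_cases hH' : H ≤ closure {a ^ 2, t}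
      · exact Or.inl hH'
      · exact Or.inr (eq_of_le_closure_pair_of_not_le ht ha hat hH hH')
    have h3 : ({closure {a, t}, zpowers a, closure {a ^ 2, a * t}} : Set (Subgroup G)).ncard ≤ 3 :=
      (Set.ncard_insert_le _ _).trans
        (Nat.succ_le_succ ((Set.ncard_insert_le _ _).trans (by simp)))
    have := ncard_le_closure_pair ht m (a ^ 2) ha2 hat2
    have := Set.ncard_le_ncard hsub
    have := Set.ncard_union_le {H : Subgroup G | H ≤ closure {a ^ 2, t}}
      {closure {a, t}, zpowers a, closure {a ^ 2, a * t}}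
    omega

lemma card_subgroup_le_of_closure_pair_eq_top [Finite G] {a t : G} {m : ℕ} {k : ℤ}
    (ht : t * t = 1) (ha : a ^ 2 ^ m = 1) (hat : t * a * t = a ^ (1 + 4 * k))
    (htop : closure {a, t} = ⊤) : Nat.card (Subgroup G) ≤ 3 * m + 2 := by
  have := ncard_le_closure_pair ht m a ha hat
  simpa [htop, Set.ncard_univ] using this

end Extension

section TwoGroup

variable {G : Type*} [Group G]

lemma exists_mem_notMem_notMem {H K L : Subgroup G} (hK : ¬ H ≤ K) (hL : ¬ H ≤ L) :
    ∃ x ∈ H, x ∉ K ∧ x ∉ L := by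
  by_contra! h
  have hsub : (H : Set G) ⊆ K ∪ L := fun x hx => by
    by_cases hxK : x ∈ K
    · exact Or.inl hxK
    · exact Or.inr (h x hx hxK)
  exact (SubgroupClass.subset_union.1 hsub).elim hK hL

lemma isCyclic_of_zpowers_eq_top {g : G} (h : zpowers g = ⊤) : IsCyclic G :=
  ⟨g, fun x => (h ▸ mem_top x : x ∈ zpowers g)⟩

lemma not_isCyclic_of_two_involutions {u v : G} (hu : u ^ 2 = 1) (hv : v ^ 2 = 1)
    (hu1 : u ≠ 1) (hv1 : v ≠ 1) (huv : u ≠ v) [Finite G] : ¬ IsCyclic G := by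
  classical
  intro hG
  have := Fintype.ofFinite G
  have h := IsCyclic.card_pow_eq_one_le (α := G) (n := 2) (by norm_num)
  have hsub : ({1, u, v} : Finset G) ⊆ Finset.univ.filter fun a : G => a ^ 2 = 1 := by
    intro x hx
    simp only [Finset.mem_insert, Finset.mem_singleton] at hx
    rcases hx with rfl | rfl | rfl <;> simp [*]
  have hcard : ({1, u, v} : Finset G).card = 3 :=
    Finset.card_eq_three.2 ⟨1, u, v, hu1.symm, hv1.symm, huv, rfl⟩
  have := Finset.card_le_card hsub
  omega

lemma card_of_index_two {n : ℕ} (hcard : Nat.card G = 2 ^ (n + 1)) {H : Subgroup G}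
    (hH : H.index = 2) : Nat.card H = 2 ^ n := by
  have h := H.card_mul_index
  rw [hH, hcard, pow_succ] at h
  exact Nat.eq_of_mul_eq_mul_right (by norm_num) h

lemma ne_top_of_index_two {H : Subgroup G} (hH : H.index = 2) : H ≠ ⊤ := by
  rintro rfl
  simp at hH

variable [Finite G] {n : ℕ}

lemma exists_index_two_ge (hcard : Nat.card G = 2 ^ n) {H : Subgroup G} (hH : H ≠ ⊤) :
    ∃ K : Subgroup G, K.index = 2 ∧ H ≤ K := by
  obtain ⟨m, hm, hHm⟩ := (Nat.dvd_prime_pow Nat.prime_two).1 (hcard ▸ H.card_subgroup_dvd_card)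
  have hmn : m < n := by
    refine lt_of_le_of_ne hm ?_
    rintro rfl
    exact hH (H.eq_top_of_card_eq (hHm.trans hcard.symm))
  obtain ⟨l, rfl⟩ : ∃ l, n = l + 1 := ⟨n - 1, by omega⟩
  have : Fact (Nat.Prime 2) := ⟨Nat.prime_two⟩
  obtain ⟨K, hK, hHK⟩ := Sylow.exists_subgroup_card_pow_prime_le 2 (n := m) (m := l)
    (hcard ▸ pow_dvd_pow 2 (Nat.le_succ l)) H hHm (by omega)
  refine ⟨K, ?_, hHK⟩
  have h := K.card_mul_index
  rw [hK, hcard, pow_succ] at h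
  exact Nat.eq_of_mul_eq_mul_left (by positivity) h

lemma eq_of_le_of_index_two {H K : Subgroup G} (hH : H.index = 2) (hK : K.index = 2)
    (h : H ≤ K) : H = K := by
  refine eq_of_le_of_card_ge h (le_of_eq ?_)
  have h1 := H.card_mul_index
  have h2 := K.card_mul_index
  rw [hH] at h1
  rw [hK] at h2
  omega

lemma exists_three_index_two (hcard : Nat.card G = 2 ^ n) (hnc : ¬ IsCyclic G) :
    ∃ M K L : Subgroup G, M.index = 2 ∧ K.index = 2 ∧ L.index = 2 ∧ M ≠ K ∧ M ≠ L ∧ K ≠ L := by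
  have hz : ∀ g : G, zpowers g ≠ ⊤ := fun g h => hnc (isCyclic_of_zpowers_eq_top h)
  obtain ⟨M, hM, -⟩ := exists_index_two_ge hcard (hz 1)
  have hM' : ¬ (⊤ : Subgroup G) ≤ M := fun h => ne_top_of_index_two hM (top_le_iff.1 h)
  obtain ⟨g, -, hg⟩ := SetLike.not_le_iff_exists.1 hM'
  obtain ⟨K, hK, hgK⟩ := exists_index_two_ge hcard (hz g)
  have hK' : ¬ (⊤ : Subgroup G) ≤ K := fun h => ne_top_of_index_two hK (top_le_iff.1 h)
  obtain ⟨x, -, hxM, hxK⟩ := exists_mem_notMem_notMem hM' hK'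
  obtain ⟨L, hL, hxL⟩ := exists_index_two_ge hcard (hz x)
  refine ⟨M, K, L, hM, hK, hL, ?_, ?_, ?_⟩ <;> rintro rfl
  exacts [hg (hgK (mem_zpowers g)), hxM (hxL (mem_zpowers x)), hxK (hxL (mem_zpowers x))]

lemma exists_two_others (hcard : Nat.card G = 2 ^ n) (hnc : ¬ IsCyclic G) (M : Subgroup G) :
    ∃ K L : Subgroup G, K.index = 2 ∧ L.index = 2 ∧ M ≠ K ∧ M ≠ L ∧ K ≠ L := by
  obtain ⟨P, Q, R, hP, hQ, hR, hPQ, hPR, hQR⟩ := exists_three_index_two hcard hnc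
  by_cases h1 : M = P
  · exact ⟨Q, R, hQ, hR, h1 ▸ hPQ, h1 ▸ hPR, hQR⟩
  by_cases h2 : M = Q
  · exact ⟨P, R, hP, hR, h1, h2 ▸ hQR, hPR⟩
  · exact ⟨P, Q, hP, hQ, h1, h2, hPQ⟩

lemma card_subgroup_eq_add (M : Subgroup G) :
    Nat.card (Subgroup G) = Nat.card (Subgroup M) + {H : Subgroup G | ¬ H ≤ M}.ncard := by
  have h := Set.ncard_add_ncard_compl {H : Subgroup G | H ≤ M}
  have h1 : {H : Subgroup G | H ≤ M}.ncard = Nat.card (Subgroup M) :=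
    (Nat.card_congr (MapSubtype.orderIso M).toEquiv).symm
  rw [← h, h1]
  rfl

lemma three_le_ncard_not_le {M K L : Subgroup G} (hM : M.index = 2) (hK : K.index = 2)
    (hL : L.index = 2) (hMK : M ≠ K) (hML : M ≠ L) (hKL : K ≠ L) :
    3 ≤ {H : Subgroup G | ¬ H ≤ M}.ncard := by
  have hsub : ({⊤, K, L} : Set (Subgroup G)) ⊆ {H : Subgroup G | ¬ H ≤ M} := by
    rintro H (rfl | rfl | rfl) h
    · exact ne_top_of_index_two hM (top_le_iff.1 h)
    · exact hMK (eq_of_le_of_index_two hK hM h).symm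
    · exact hML (eq_of_le_of_index_two hL hM h).symm
  have h3 : ({⊤, K, L} : Set (Subgroup G)).ncard = 3 :=
    Set.ncard_eq_three.2 ⟨⊤, K, L, (ne_top_of_index_two hK).symm, (ne_top_of_index_two hL).symm,
      hKL, rfl⟩
  exact h3 ▸ Set.ncard_le_ncard hsub

lemma five_le_ncard_not_le (hnc : ¬ IsCyclic G) {M K L : Subgroup G} (hM : M.index = 2)
    (hK : K.index = 2) (hL : L.index = 2) (hMK : M ≠ K) (hML : M ≠ L) (hKL : K ≠ L)
    (hKnc : ¬ IsCyclic K) : 5 ≤ {H : Subgroup G | ¬ H ≤ M}.ncard := by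
  classical
  have hKM : ¬ K ≤ M := fun h => hMK (eq_of_le_of_index_two hK hM h).symm
  have hzK : ∀ g ∈ K, zpowers g ≠ K := by
    rintro g - rfl
    exact hKnc inferInstance
  have hzL : ∀ g ∈ K, zpowers g ≠ L := by
    rintro g hg rfl
    exact hKL (eq_of_le_of_index_two hL hK (zpowers_le.2 hg)).symm
  have hz : ∀ g : G, zpowers g ≠ ⊤ := fun g h => hnc (isCyclic_of_zpowers_eq_top h)
  obtain ⟨x, hxK, hxM⟩ := SetLike.not_le_iff_exists.1 hKM
  have hKx : ¬ K ≤ zpowers x := fun h => hzK x hxK (le_antisymm (zpowers_le.2 hxK) h)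
  obtain ⟨y, hyK, hyM, hyx⟩ := exists_mem_notMem_notMem hKM hKx
  have hxy : zpowers x ≠ zpowers y := fun h => hyx (h ▸ mem_zpowers y)
  have hsub : ((({⊤, K, L, zpowers x, zpowers y} : Finset (Subgroup G))) : Set (Subgroup G)) ⊆
      {H : Subgroup G | ¬ H ≤ M} := by
    intro H hH h
    simp only [Finset.coe_insert, Finset.coe_singleton, Set.mem_insert_iff,
      Set.mem_singleton_iff] at hH
    rcases hH with rfl | rfl | rfl | rfl | rfl
    · exact ne_top_of_index_two hM (top_le_iff.1 h)
    · exact hKM h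
    · exact hML (eq_of_le_of_index_two hL hM h).symm
    · exact hxM (h (mem_zpowers x))
    · exact hyM (h (mem_zpowers y))
  have h5 : ({⊤, K, L, zpowers x, zpowers y} : Finset (Subgroup G)).card = 5 := by
    rw [Finset.card_insert_of_notMem, Finset.card_insert_of_notMem, Finset.card_insert_of_notMem,
      Finset.card_insert_of_notMem, Finset.card_singleton]
    · simpa using hxy
    · simpa using ⟨(hzL x hxK).symm, (hzL y hyK).symm⟩
    · simpa using ⟨hKL, (hzK x hxK).symm, (hzK y hyK).symm⟩
    · simpa using ⟨(ne_top_of_index_two hK).symm, (ne_top_of_index_two hL).symm,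
        (hz x).symm, (hz y).symm⟩
  have := Set.ncard_le_ncard hsub
  rwa [Set.ncard_coe_finset, h5] at this

lemma eq_one_or_eq_of_mem_zpowers_of_sq_eq_one {a x : G} (ha : orderOf a = 2 ^ (n + 1))
    (hx : x ∈ zpowers a) (hx2 : x ^ 2 = 1) : x = 1 ∨ x = a ^ 2 ^ n := by
  by_contra! ⟨hx1, hxc⟩
  have hc2 : (a ^ 2 ^ n) ^ 2 = 1 := by rw [← pow_mul, ← pow_succ, ← ha, pow_orderOf_eq_one]
  have hc1 : a ^ 2 ^ n ≠ 1 := by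
    refine pow_ne_one_of_lt_orderOf (by positivity) ?_
    rw [ha]
    exact Nat.pow_lt_pow_right (by norm_num) (Nat.lt_succ_self n)
  have hca : a ^ 2 ^ n ∈ zpowers a := pow_mem (mem_zpowers a) _
  refine not_isCyclic_of_two_involutions (G := zpowers a) (u := ⟨x, hx⟩) (v := ⟨_, hca⟩)
    ?_ ?_ ?_ ?_ ?_ inferInstance <;> simpa [Subtype.ext_iff]

/-- A group of order `2 ^ (m + 4)` with two cyclic maximal subgroups is generated by one of them
together with an involution acting on it as a modular automorphism. -/
lemma exists_involution_of_two_cyclic {m : ℕ} (hcard : Nat.card G = 2 ^ (m + 4)) {A B : Subgroup G}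
    (hA : A.index = 2) (hB : B.index = 2) (hAB : A ≠ B) [IsCyclic A] [IsCyclic B] :
    ∃ a t : G, orderOf a = 2 ^ (m + 3) ∧ zpowers a = A ∧ t ∉ A ∧ t * t = 1 ∧
      (t * a * t = a ∨ t * a * t = a ^ (1 + 2 ^ (m + 2))) := by
  have hgen : ∀ C : Subgroup G, IsCyclic C → ∃ c : G, zpowers c = C := fun C hC => by
    obtain ⟨c, hc⟩ := hC
    refine ⟨c, le_antisymm (zpowers_le.2 c.2) fun x hx => ?_⟩
    obtain ⟨k, hk⟩ := mem_zpowers_iff.1 (hc ⟨x, hx⟩)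
    exact mem_zpowers_iff.2 ⟨k, by simpa using congrArg Subtype.val hk⟩
  obtain ⟨a, rfl⟩ := hgen A inferInstance
  obtain ⟨b, rfl⟩ := hgen B inferInstance
  have hao : orderOf a = 2 ^ (m + 3) := by
    rw [← Nat.card_zpowers]; exact card_of_index_two hcard hA
  have ha1 : a ^ 2 ^ (m + 3) = 1 := by rw [← hao, pow_orderOf_eq_one]
  have hbA : b ∉ zpowers a := fun h =>
    hAB (eq_of_le_of_index_two hB hA (zpowers_le.2 h)).symm
  have haB : a ∉ zpowers b := fun h => hAB (eq_of_le_of_index_two hA hB (zpowers_le.2 h))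
  have hcomm : Commute (a ^ 2) b := by
    obtain ⟨k, hk⟩ := mem_zpowers_iff.1 (sq_mem_of_index_two hB a)
    rw [← hk]
    exact (Commute.refl b).zpow_left k
  obtain ⟨i, hi⟩ := mem_zpowers_iff.1 (sq_mem_of_index_two hA b)
  have hieven : Even i := by
    rw [← Int.not_odd_iff_even]
    intro hodd
    have h := mem_zpowers_zpow_of_odd ha1 hodd
    rw [hi] at h
    exact haB ((zpowers_le.2 (pow_mem (mem_zpowers b) 2)) h)
  obtain ⟨j, rfl⟩ := even_iff_exists_two_mul.1 hieven
  have hnormal := normal_of_index_eq_two hA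
  obtain ⟨r, hr⟩ := mem_zpowers_iff.1 (hnormal.conj_mem a (mem_zpowers a) b)
  have hr2 : (a ^ r) ^ 2 = a ^ 2 := by
    rw [hr, conj_pow, ← hcomm.eq, mul_inv_cancel_right]
  have hrc : a ^ r = a ∨ a ^ r = a ^ (1 + 2 ^ (m + 2)) := by
    have hsq : (a ^ (r - 1)) ^ 2 = 1 := by
      rw [zpow_sub_one, Commute.mul_pow (by exact ((Commute.refl a).zpow_left r).inv_right), hr2,
        inv_pow, mul_inv_cancel]
    rcases eq_one_or_eq_of_mem_zpowers_of_sq_eq_one hao (zpow_mem (mem_zpowers a) _) hsq with h | h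
    · left
      rwa [zpow_sub_one, mul_inv_eq_one] at h
    · right
      rw [pow_add, pow_one, ← h, ← zpow_one_add]
      congr 1
      ring
  have hu : ∀ l : ℤ, b * a ^ l ∉ zpowers a ∧ b * a ^ l * a * (b * a ^ l)⁻¹ = a ^ r := by
    refine fun l => ⟨fun h => hbA ?_, ?_⟩
    · exact ((zpowers a).mul_mem_cancel_right (zpow_mem (mem_zpowers a) l)).1 h
    · rw [hr, mul_inv_rev, mul_assoc b, ← zpow_add_one, add_comm, zpow_one_add]
      group
  suffices h : ∃ l : ℤ, (b * a ^ l) * (b * a ^ l) = 1 by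
    obtain ⟨l, hl⟩ := h
    have hinv : (b * a ^ l)⁻¹ = b * a ^ l := inv_eq_of_mul_eq_one_left hl
    have hlr := (hu l).2
    rw [hinv] at hlr
    exact ⟨a, b * a ^ l, hao, rfl, (hu l).1, hl, hlr ▸ hrc⟩
  have hsq : (b * a ^ (-j)) ^ 2 = a ^ (j * (1 - r)) := by
    have h1 : b * a ^ (-j) * b⁻¹ = a ^ (r * -j) := by rw [← conj_zpow, ← hr, zpow_mul]
    calc (b * a ^ (-j)) ^ 2 = (b * a ^ (-j) * b⁻¹) * b ^ 2 * a ^ (-j) := by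
          rw [pow_two, pow_two]; group
      _ = a ^ (j * (1 - r)) := by
          rw [h1, ← hi, ← zpow_add, ← zpow_add]; congr 1; ring
  have hsq2 : (a ^ (j * (1 - r))) ^ 2 = 1 := by
    have h1 : (a ^ 2) ^ (1 - r) = 1 := by
      rw [zpow_sub, zpow_one, mul_inv_eq_one, ← zpow_natCast, ← zpow_mul, mul_comm, zpow_mul,
        zpow_natCast, zpow_natCast, hr2]
    calc (a ^ (j * (1 - r))) ^ 2 = ((a ^ 2) ^ (1 - r)) ^ j := by
          rw [← zpow_natCast, ← zpow_natCast, ← zpow_mul, ← zpow_mul, ← zpow_mul]; congr 1; ring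
      _ = 1 := by rw [h1, one_zpow]
  rcases eq_one_or_eq_of_mem_zpowers_of_sq_eq_one hao (zpow_mem (mem_zpowers a) _) hsq2 with h | h
  · exact ⟨-j, by rw [← pow_two, hsq, h]⟩
  · refine ⟨-j + 2 ^ (m + 1), ?_⟩
    have hd : a ^ ((2 : ℤ) ^ (m + 1)) = (a ^ 2) ^ 2 ^ m := by
      rw [← pow_mul, ← pow_succ']; exact_mod_cast rfl
    have hdc : Commute (b * a ^ (-j)) ((a ^ 2) ^ 2 ^ m) :=
      ((hcomm.symm.pow_right _).mul_left
        ((((Commute.refl a).zpow_left (-j)).pow_right 2).pow_right _))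
    rw [← pow_two, zpow_add, ← mul_assoc, hd, hdc.mul_pow, hsq, h, ← pow_mul, ← pow_mul,
      ← pow_add, ← ha1]
    congr 1
    ring

/-- A noncyclic `2`-group with two cyclic maximal subgroups has a maximal subgroup
with two involutions. -/
lemma exists_index_two_with_two_involutions {m : ℕ} (hcard : Nat.card G = 2 ^ (m + 4))
    {A B : Subgroup G} (hA : A.index = 2) (hB : B.index = 2) (hAB : A ≠ B)
    [IsCyclic A] [IsCyclic B] :
    ∃ M : Subgroup G, M.index = 2 ∧ ∃ u v : M, u ^ 2 = 1 ∧ v ^ 2 = 1 ∧ u ≠ 1 ∧ v ≠ 1 ∧ u ≠ v := by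
  obtain ⟨a, t, hao, rfl, htA, ht, -⟩ := exists_involution_of_two_cyclic hcard hA hB hAB
  have hne : zpowers t ≠ ⊤ := by
    intro h
    have h1 := Nat.card_zpowers t
    rw [h, card_top, hcard] at h1
    have h2 := orderOf_le_of_pow_eq_one two_pos ((pow_two t).trans ht)
    rw [← h1, pow_add] at h2
    have := Nat.one_le_two_pow (n := m)
    omega
  obtain ⟨M, hM, htM⟩ := exists_index_two_ge hcard hne
  have hc : a ^ 2 ^ (m + 2) ∈ M := by
    rw [pow_succ' 2, pow_mul]
    exact pow_mem (sq_mem_of_index_two hM a) _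
  refine ⟨M, hM, ⟨_, hc⟩, ⟨t, htM (mem_zpowers t)⟩, ?_, ?_, ?_, ?_, ?_⟩ <;>
    simp only [ne_eq, Subtype.ext_iff, coe_pow, coe_one]
  · rw [← pow_mul, ← pow_succ, ← hao, pow_orderOf_eq_one]
  · rw [pow_two, ht]
  · refine pow_ne_one_of_lt_orderOf (by positivity) ?_
    rw [hao]
    exact Nat.pow_lt_pow_right (by norm_num) (Nat.lt_succ_self _)
  · rintro rfl
    exact htA (one_mem _)
  · rintro rfl
    exact htA (pow_mem (mem_zpowers a) _)

end TwoGroup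

section LowerBound

lemma card_subgroup_add_three_le {G : Type*} [Group G] [Finite G] {n : ℕ}
    (hcard : Nat.card G = 2 ^ n) (hnc : ¬ IsCyclic G) {M : Subgroup G} (hM : M.index = 2) :
    Nat.card (Subgroup M) + 3 ≤ Nat.card (Subgroup G) := by
  obtain ⟨K, L, hK, hL, hMK, hML, hKL⟩ := exists_two_others hcard hnc M
  have := three_le_ncard_not_le hM hK hL hMK hML hKL
  have := card_subgroup_eq_add M
  omega

lemma three_le_card_subgroup_of_card_eq_four {G : Type*} [Group G] [Finite G]
    (hcard : Nat.card G = 2 ^ 2) : 3 ≤ Nat.card (Subgroup G) := by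
  have htb : (⊥ : Subgroup G) ≠ ⊤ := by
    intro h
    have := card_bot (G := G)
    rw [h, card_top, hcard] at this
    norm_num at this
  obtain ⟨K, hK, -⟩ := exists_index_two_ge hcard htb
  have hKb : ⊥ ≠ K := by
    rintro rfl
    rw [index_bot, hcard] at hK
    norm_num at hK
  have h3 : ({⊥, K, ⊤} : Set (Subgroup G)).ncard = 3 :=
    Set.ncard_eq_three.2 ⟨⊥, K, ⊤, hKb, htb, ne_top_of_index_two hK, rfl⟩
  have := Set.ncard_le_ncard (Set.subset_univ ({⊥, K, ⊤} : Set (Subgroup G)))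
  rwa [h3, Set.ncard_univ] at this

lemma five_le_card_subgroup_of_card_eq_four {G : Type*} [Group G] [Finite G]
    (hcard : Nat.card G = 2 ^ 2) (hnc : ¬ IsCyclic G) : 5 ≤ Nat.card (Subgroup G) := by
  obtain ⟨M, -, -, hM, -⟩ := exists_three_index_two hcard hnc
  have hMc := card_of_index_two hcard hM
  have : Nontrivial M := Finite.one_lt_card_iff_nontrivial.1 (by rw [hMc]; norm_num)
  have := Finite.one_lt_card (α := Subgroup M)
  have := card_subgroup_add_three_le hcard hnc hM
  omega

lemma six_le_card_subgroup_of_card_eq_eight {G : Type*} [Group G] [Finite G]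
    (hcard : Nat.card G = 2 ^ 3) (hnc : ¬ IsCyclic G) : 6 ≤ Nat.card (Subgroup G) := by
  obtain ⟨M, -, -, hM, -⟩ := exists_three_index_two hcard hnc
  have := three_le_card_subgroup_of_card_eq_four (card_of_index_two hcard hM)
  have := card_subgroup_add_three_le hcard hnc hM
  omega

lemma exists_central_involution {G : Type*} [Group G] [Finite G] {n : ℕ}
    (hcard : Nat.card G = 2 ^ (n + 1)) : ∃ z ∈ center G, z ^ 2 = 1 ∧ z ≠ 1 := by
  have : Fact (Nat.Prime 2) := ⟨Nat.prime_two⟩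
  have hp : IsPGroup 2 G := IsPGroup.of_card hcard
  have : Nontrivial G := Finite.one_lt_card_iff_nontrivial.1
    (by rw [hcard]; exact Nat.one_lt_two_pow (Nat.succ_ne_zero n))
  have := hp.center_nontrivial
  have hdvd : 2 ∣ Nat.card (center G) := by
    obtain ⟨k, hk, hk'⟩ := (Nat.dvd_prime_pow Nat.prime_two).1
      (hcard ▸ (center G).card_subgroup_dvd_card)
    rw [hk']
    refine dvd_pow_self 2 ?_
    rintro rfl
    have := Finite.one_lt_card (α := center G)
    omega
  obtain ⟨z, hz⟩ := exists_prime_orderOf_dvd_card' 2 hdvd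
  refine ⟨z, z.2, ?_, ?_⟩
  · have := pow_orderOf_eq_one z
    rw [hz] at this
    exact_mod_cast congrArg Subtype.val this
  · intro h
    rw [OneMemClass.coe_eq_one] at h
    simp [h] at hz

lemma eight_le_card_subgroup_of_two_involutions {G : Type*} [Group G] [Finite G]
    (hcard : Nat.card G = 2 ^ 3) {u v : G} (hu : u ^ 2 = 1) (hv : v ^ 2 = 1)
    (hu1 : u ≠ 1) (hv1 : v ≠ 1) (huv : u ≠ v) : 8 ≤ Nat.card (Subgroup G) := by
  have hnc := not_isCyclic_of_two_involutions hu hv hu1 hv1 huv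
  obtain ⟨z, hz, hz2, hz1⟩ := exists_central_involution hcard
  obtain ⟨w, hw2, hw1, hzw⟩ : ∃ w : G, w ^ 2 = 1 ∧ w ≠ 1 ∧ z ≠ w := by
    by_cases h : z = u
    · exact ⟨v, hv, hv1, h ▸ huv⟩
    · exact ⟨u, hu, hu1, h⟩
  have hww : w * w = 1 := by rw [← pow_two, hw2]
  have hne : closure {z, w} ≠ ⊤ := by
    intro h
    have h5 := card_subgroup_le_of_closure_pair_eq_top (m := 1) (k := 0) hww (by simpa using hz2)
      (by rw [(mem_center_iff.1 hz w), mul_assoc, hww]; simp) h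
    have := six_le_card_subgroup_of_card_eq_eight hcard hnc
    omega
  obtain ⟨M, hM, hle⟩ := exists_index_two_ge hcard hne
  have hzM : z ∈ M := hle (subset_closure (by simp))
  have hwM : w ∈ M := hle (subset_closure (by simp))
  have hMnc : ¬ IsCyclic M := by
    refine not_isCyclic_of_two_involutions (u := ⟨z, hzM⟩) (v := ⟨w, hwM⟩) ?_ ?_ ?_ ?_ ?_ <;>
      simpa [Subtype.ext_iff]
  have := five_le_card_subgroup_of_card_eq_four (card_of_index_two hcard hM) hMnc
  have := card_subgroup_add_three_le hcard hnc hM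
  omega

lemma eleven_le_card_subgroup_of_card_eq_sixteen {G : Type*} [Group G] [Finite G]
    (hcard : Nat.card G = 2 ^ 4) (hnc : ¬ IsCyclic G) : 11 ≤ Nat.card (Subgroup G) := by
  obtain ⟨M, K, L, hM, hK, hL, hMK, hML, hKL⟩ := exists_three_index_two hcard hnc
  have hcyc : ∀ {A B : Subgroup G}, A.index = 2 → B.index = 2 → A ≠ B → IsCyclic A → IsCyclic B →
      11 ≤ Nat.card (Subgroup G) := by
    intro A B hA hB hAB _ _
    obtain ⟨N, hN, u, v, hu, hv, hu1, hv1, huv⟩ :=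
      exists_index_two_with_two_involutions (m := 0) hcard hA hB hAB
    have := eight_le_card_subgroup_of_two_involutions (card_of_index_two hcard hN) hu hv hu1 hv1 huv
    have := card_subgroup_add_three_le hcard hnc hN
    omega
  have hnoncyc : ∀ {A B C : Subgroup G}, A.index = 2 → B.index = 2 → C.index = 2 → A ≠ B → A ≠ C →
      B ≠ C → ¬ IsCyclic A → ¬ IsCyclic B → 11 ≤ Nat.card (Subgroup G) := by
    intro A B C hA hB hC hAB hAC hBC hAnc hBnc
    have := five_le_ncard_not_le hnc hA hB hC hAB hAC hBC hBnc
    have := six_le_card_subgroup_of_card_eq_eight (card_of_index_two hcard hA) hAnc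
    have := card_subgroup_eq_add A
    omega
  by_cases hMc : IsCyclic M <;> by_cases hKc : IsCyclic K
  · exact hcyc hM hK hMK hMc hKc
  · by_cases hLc : IsCyclic L
    · exact hcyc hM hL hML hMc hLc
    · exact hnoncyc hK hL hM hKL hMK.symm hML.symm hKc hLc
  · by_cases hLc : IsCyclic L
    · exact hcyc hK hL hKL hKc hLc
    · exact hnoncyc hM hL hK hML hMK hKL.symm hMc hLc
  · exact hnoncyc hM hK hL hMK hML hKL hMc hKc

lemma exists_noncyclic_index_two {G : Type*} [Group G] [Finite G] {m : ℕ}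
    (hcard : Nat.card G = 2 ^ (m + 4)) (hnc : ¬ IsCyclic G) :
    ∃ M : Subgroup G, M.index = 2 ∧ ¬ IsCyclic M := by
  obtain ⟨M, K, L, hM, hK, hL, hMK, hML, hKL⟩ := exists_three_index_two hcard hnc
  by_cases hMc : IsCyclic M
  · by_cases hKc : IsCyclic K
    · obtain ⟨N, hN, u, v, hu, hv, hu1, hv1, huv⟩ :=
        exists_index_two_with_two_involutions hcard hM hK hMK
      exact ⟨N, hN, not_isCyclic_of_two_involutions hu hv hu1 hv1 huv⟩
    · exact ⟨K, hK, hKc⟩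
  · exact ⟨M, hM, hMc⟩

lemma le_card_subgroup_of_not_isCyclic : ∀ (m : ℕ) (G : Type*) [Group G] [Finite G],
    Nat.card G = 2 ^ (m + 4) → ¬ IsCyclic G → 3 * m + 11 ≤ Nat.card (Subgroup G)
  | 0, _, _, _, hcard, hnc => eleven_le_card_subgroup_of_card_eq_sixteen hcard hnc
  | m + 1, G, _, _, hcard, hnc => by
    obtain ⟨M, hM, hMnc⟩ := exists_noncyclic_index_two hcard hnc
    have := le_card_subgroup_of_not_isCyclic m M (card_of_index_two hcard hM) hMnc
    have := card_subgroup_add_three_le hcard hnc hM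
    omega

lemma exists_involution_of_card_subgroup_le {G : Type*} [Group G] [Finite G] {m : ℕ}
    (hcard : Nat.card G = 2 ^ (m + 5)) (hnc : ¬ IsCyclic G)
    (hle : Nat.card (Subgroup G) ≤ 3 * m + 14) :
    ∃ a t : G, orderOf a = 2 ^ (m + 4) ∧ (zpowers a).index = 2 ∧ t ∉ zpowers a ∧ t * t = 1 ∧
      (t * a * t = a ∨ t * a * t = a ^ (1 + 2 ^ (m + 3))) := by
  obtain ⟨M, hM, hMnc⟩ := exists_noncyclic_index_two (m := m + 1) hcard hnc
  obtain ⟨K, L, hK, hL, hMK, hML, hKL⟩ := exists_two_others hcard hnc M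
  have h1 := le_card_subgroup_of_not_isCyclic m M (card_of_index_two hcard hM) hMnc
  have h2 := card_subgroup_eq_add M
  have hKc : IsCyclic K := by
    by_contra h
    have := five_le_ncard_not_le hnc hM hK hL hMK hML hKL h
    omega
  have hLc : IsCyclic L := by
    by_contra h
    have := five_le_ncard_not_le hnc hM hL hK hML hMK hKL.symm h
    omega
  obtain ⟨a, t, hao, rfl, h⟩ := exists_involution_of_two_cyclic (m := m + 1) hcard hK hL hKL
  exact ⟨a, t, hao, hK, h⟩

end LowerBound

section Models

variable {G : Type*} [Group G]

lemma eq_top_of_zpowers_index_two {a t : G} (hA : (zpowers a).index = 2) (ht : t ∉ zpowers a)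
    {R : Subgroup G} (haR : a ∈ R) (htR : t ∈ R) : R = ⊤ := by
  refine (eq_top_iff' R).2 fun g => ?_
  by_cases hg : g ∈ zpowers a
  · exact zpowers_le.2 haR hg
  · have hgt : g * t ∈ zpowers a := (mul_mem_iff_of_index_two hA).2 (by tauto)
    exact (R.mul_mem_cancel_right htR).1 (zpowers_le.2 haR hgt)

lemma nonempty_mulEquiv_of_range [Finite G] {K : Type*} [Group K] (f : K →* G) {a t : G}
    (hA : (zpowers a).index = 2) (ht : t ∉ zpowers a) (haR : a ∈ f.range) (htR : t ∈ f.range)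
    [Finite K] (hcard : Nat.card K = Nat.card G) : Nonempty (G ≃* K) := by
  have hsurj : Function.Surjective f :=
    MonoidHom.range_eq_top.1 (eq_top_of_zpowers_index_two hA ht haR htR)
  have hbij : Function.Bijective f := hsurj.bijective_of_nat_card_le hcard.le
  exact ⟨(MulEquiv.ofBijective f hbij).symm⟩

lemma nonempty_mulEquiv_prod [Finite G] {m : ℕ} {a t : G} (ha : orderOf a = 2 ^ m)
    (hA : (zpowers a).index = 2) (ht : t ∉ zpowers a) (htt : t * t = 1) (hat : t * a * t = a) :
    Nonempty (G ≃* Multiplicative (ZMod 2) × Multiplicative (ZMod (2 ^ m))) := by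
  have : NeZero (2 ^ m) := ⟨by positivity⟩
  have ht1 : t ≠ 1 := by
    rintro rfl
    exact ht (one_mem _)
  have hto : orderOf t = 2 := orderOf_eq_prime (by rw [pow_two, htt]) ht1
  have hcomm : Commute t a := by
    have : t⁻¹ = t := inv_eq_of_mul_eq_one_left htt
    exact mul_inv_eq_iff_eq_mul.1 (by rw [this, hat])
  let e₁ : Multiplicative (ZMod 2) ≃* zpowers t :=
    mulEquivOfCyclicCardEq (by simp [Nat.card_zpowers, hto])
  let e₂ : Multiplicative (ZMod (2 ^ m)) ≃* zpowers a :=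
    mulEquivOfCyclicCardEq (by simp [Nat.card_zpowers, ha])
  let f₁ := (zpowers t).subtype.comp e₁.toMonoidHom
  let f₂ := (zpowers a).subtype.comp e₂.toMonoidHom
  have hf : ∀ p q, Commute (f₁ p) (f₂ q) := by
    intro p q
    obtain ⟨i, hi⟩ := mem_zpowers_iff.1 (e₁ p).2
    obtain ⟨j, hj⟩ := mem_zpowers_iff.1 (e₂ q).2
    change Commute (e₁ p : G) (e₂ q : G)
    rw [← hi, ← hj]
    exact hcomm.zpow_zpow i j
  refine nonempty_mulEquiv_of_range (f₁.noncommCoprod f₂ hf) hA ht ?_ ?_ ?_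
  · exact ⟨(1, e₂.symm ⟨a, mem_zpowers a⟩), by simp [f₁, f₂]⟩
  · exact ⟨(e₁.symm ⟨t, mem_zpowers t⟩, 1), by simp [f₁, f₂]⟩
  · rw [← (zpowers a).card_mul_index, hA, Nat.card_zpowers, ha, Nat.card_prod]
    simp [mul_comm]

end Models

section Prod

lemma card_subgroup_prod (m : ℕ) :
    Nat.card (Subgroup (Multiplicative (ZMod 2) × Multiplicative (ZMod (2 ^ (m + 4))))) =
      3 * m + 14 := by
  have : NeZero (2 ^ (m + 4)) := ⟨by positivity⟩
  have hcard : Nat.card (Multiplicative (ZMod 2) × Multiplicative (ZMod (2 ^ (m + 4)))) =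
      2 ^ ((m + 1) + 4) := by
    rw [Nat.card_prod]
    simp
    ring
  have hnc : ¬ IsCyclic (Multiplicative (ZMod 2) × Multiplicative (ZMod (2 ^ (m + 4)))) := by
    intro h
    have h2 := (Group.isCyclic_prod_iff.1 h).2.2
    simp at h2
  refine le_antisymm ?_ ((le_card_subgroup_of_not_isCyclic (m + 1) _ hcard hnc).trans' (by omega))
  let a : Multiplicative (ZMod 2) × Multiplicative (ZMod (2 ^ (m + 4))) :=
    (1, Multiplicative.ofAdd 1)
  let t : Multiplicative (ZMod 2) × Multiplicative (ZMod (2 ^ (m + 4))) :=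
    (Multiplicative.ofAdd 1, 1)
  have ht : t * t = 1 := Prod.ext
    (show Multiplicative.ofAdd (1 : ZMod 2) * Multiplicative.ofAdd 1 = 1 by decide) (one_mul 1)
  have ha : a ^ 2 ^ (m + 4) = 1 := by
    refine Prod.ext (by simp [a]) ?_
    simp only [a, Prod.pow_snd, ← ofAdd_nsmul, nsmul_eq_mul, mul_one, ZMod.natCast_self]
    rfl
  have hat : t * a * t = a ^ (1 + 4 * (0 : ℤ)) := by
    rw [mul_comm t a, mul_assoc, ht]
    simp
  have htop : Subgroup.closure {a, t} = ⊤ := by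
    refine (eq_top_iff' _).2 fun x => ?_
    have hx : x = t ^ (x.1.toAdd).val * a ^ (x.2.toAdd).val := by
      refine Prod.ext ?_ ?_ <;> simp [a, t, ← ofAdd_nsmul]
    rw [hx]
    exact mul_mem (pow_mem (Subgroup.subset_closure (by simp)) _)
      (pow_mem (Subgroup.subset_closure (by simp)) _)
  exact (card_subgroup_le_of_closure_pair_eq_top ht ha hat htop).trans (by omega)

end Prod

namespace ModularGroup

def genX (p n : ℕ) : ModularGroup p n := PresentedGroup.of (rels := modularRels p n) 0

def genY (p n : ℕ) : ModularGroup p n := PresentedGroup.of (rels := modularRels p n) 1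

lemma genX_pow (p n : ℕ) : genX p n ^ p ^ (n - 1) = 1 :=
  PresentedGroup.one_of_mem (rels := modularRels p n) (by simp [modularRels])

lemma genY_pow (p n : ℕ) : genY p n ^ p = 1 :=
  PresentedGroup.one_of_mem (rels := modularRels p n) (by simp [modularRels])

lemma conj_genX (p n : ℕ) : (genY p n)⁻¹ * genX p n * genY p n = genX p n ^ (1 + p ^ (n - 2)) :=
  mul_inv_eq_one.1 (PresentedGroup.one_of_mem (rels := modularRels p n) (by simp [modularRels]))

lemma closure_gens (p n : ℕ) : closure {genX p n, genY p n} = ⊤ := by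
  have h := PresentedGroup.closure_range_of (modularRels p n)
  have hr : Set.range (PresentedGroup.of (rels := modularRels p n)) = {genX p n, genY p n} := by
    ext x
    simp only [Set.mem_range, Fin.exists_fin_two]
    exact or_congr eq_comm eq_comm
  rw [hr] at h
  exact h

lemma exists_hom {G : Type*} [Group G] {p n : ℕ} {a t : G} (ha : a ^ p ^ (n - 1) = 1)
    (ht : t ^ p = 1) (hat : t⁻¹ * a * t = a ^ (1 + p ^ (n - 2))) :
    ∃ f : ModularGroup p n →* G, f (genX p n) = a ∧ f (genY p n) = t := by
  have hrels : ∀ r ∈ modularRels p n, FreeGroup.lift ![a, t] r = 1 := by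
    rintro r (rfl | rfl | rfl) <;> simp [ha, ht, hat]
  exact ⟨PresentedGroup.toGroup hrels, PresentedGroup.toGroup.of hrels,
    PresentedGroup.toGroup.of hrels⟩

section Two

variable (m : ℕ)

lemma genY_mul_genY : genY 2 (m + 5) * genY 2 (m + 5) = 1 := by
  rw [← pow_two, genY_pow]

lemma genY_conj : genY 2 (m + 5) * genX 2 (m + 5) * genY 2 (m + 5) =
    genX 2 (m + 5) ^ (1 + 4 * (2 : ℤ) ^ (m + 1)) := by
  have h := conj_genX 2 (m + 5)
  rw [inv_eq_of_mul_eq_one_left (genY_mul_genY m)] at h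
  rw [h, ← zpow_natCast]
  congr 1
  rw [Nat.add_sub_assoc (by norm_num)]
  push_cast
  ring

lemma zpow_apply_of_apply_eq_add_one {R : Type*} [Ring R] {f : Equiv.Perm R}
    (hf : ∀ v, f v = v + 1) (i : ℤ) (v : R) : (f ^ i) v = v + i := by
  induction i with
  | zero => simp
  | succ i ih => rw [add_comm, zpow_one_add, Equiv.Perm.mul_apply, ih, hf]; push_cast; abel
  | pred i ih =>
    rw [← f.injective.eq_iff, ← Equiv.Perm.mul_apply, ← zpow_one_add, add_sub_cancel, ih, hf]
    push_cast
    abel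

/-- The modular group acts on `ZMod (2 ^ (n - 1))` by affine permutations. -/
lemma exists_affine_rep : ∃ f : ModularGroup 2 (m + 5) →* Equiv.Perm (ZMod (2 ^ (m + 4))),
    (∀ v, f (genX 2 (m + 5)) v = v + 1) ∧
      ∀ v, f (genY 2 (m + 5)) v = (1 + 2 ^ (m + 3)) * v := by
  have h2 : (2 : ZMod (2 ^ (m + 4))) ^ (m + 4) = 0 := by
    exact_mod_cast ZMod.natCast_self (2 ^ (m + 4))
  have hr : (1 + 2 ^ (m + 3) : ZMod (2 ^ (m + 4))) * (1 + 2 ^ (m + 3)) = 1 := by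
    calc (1 + 2 ^ (m + 3) : ZMod (2 ^ (m + 4))) * (1 + 2 ^ (m + 3))
        = 1 + 2 ^ (m + 4) * (1 + 2 ^ (m + 2)) := by ring
      _ = 1 := by rw [h2, zero_mul, add_zero]
  have hinv : Function.Involutive fun v : ZMod (2 ^ (m + 4)) => (1 + 2 ^ (m + 3)) * v := fun v => by
    simp only [← mul_assoc, hr, one_mul]
  have hy : hinv.toPerm * hinv.toPerm = 1 := Equiv.ext hinv
  have hyi : hinv.toPerm⁻¹ = hinv.toPerm := inv_eq_of_mul_eq_one_left hy
  have hx := zpow_apply_of_apply_eq_add_one (f := Equiv.addRight (1 : ZMod (2 ^ (m + 4))))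
    fun _ => rfl
  have hxN : Equiv.addRight (1 : ZMod (2 ^ (m + 4))) ^ 2 ^ (m + 5 - 1) = 1 := by
    ext1 v
    rw [← zpow_natCast, hx]
    simp [h2]
  have hxy : hinv.toPerm⁻¹ * Equiv.addRight (1 : ZMod (2 ^ (m + 4))) * hinv.toPerm =
      Equiv.addRight 1 ^ (1 + 2 ^ (m + 5 - 2)) := by
    rw [hyi]
    ext1 v
    rw [← zpow_natCast, hx]
    simp only [Equiv.Perm.mul_apply, Equiv.coe_addRight, Function.Involutive.coe_toPerm]
    rw [mul_add, ← mul_assoc, hr, one_mul]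
    simp
  obtain ⟨f, hfx, hfy⟩ := exists_hom hxN (by rw [pow_two, hy]) hxy
  exact ⟨f, fun v => by rw [hfx]; rfl, fun v => by rw [hfy]; rfl⟩

variable {m} in
lemma one_add_two_pow_ne_one : (1 + 2 ^ (m + 3) : ZMod (2 ^ (m + 4))) ≠ 1 := by
  intro h
  have h0 : ((2 ^ (m + 3) : ℕ) : ZMod (2 ^ (m + 4))) = 0 := by
    push_cast
    simpa using h
  rw [ZMod.natCast_eq_zero_iff] at h0
  have := (Nat.pow_dvd_pow_iff_le_right (by norm_num)).1 h0
  omega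

lemma orderOf_genX : orderOf (genX 2 (m + 5)) = 2 ^ (m + 4) := by
  obtain ⟨f, hfx, -⟩ := exists_affine_rep m
  refine Nat.dvd_antisymm (orderOf_dvd_of_pow_eq_one (genX_pow 2 (m + 5))) ?_
  have h := congrArg (fun g => f g 0) (pow_orderOf_eq_one (genX 2 (m + 5)))
  rw [← ZMod.natCast_eq_zero_iff]
  simpa [← zpow_natCast, zpow_apply_of_apply_eq_add_one hfx] using h

lemma genY_notMem : genY 2 (m + 5) ∉ zpowers (genX 2 (m + 5)) := by
  obtain ⟨f, hfx, hfy⟩ := exists_affine_rep m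
  rintro ⟨i, hi⟩
  have h : ∀ v, v + (i : ZMod (2 ^ (m + 4))) = (1 + 2 ^ (m + 3)) * v := fun v => by
    have h1 := congrArg (fun g => f g v) hi
    simpa [zpow_apply_of_apply_eq_add_one hfx, hfy] using h1
  have h0 : (i : ZMod (2 ^ (m + 4))) = 0 := by simpa using h 0
  have h1 := h 1
  rw [h0, add_zero, mul_one] at h1
  exact one_add_two_pow_ne_one h1.symm

lemma index_zpowers_genX : (zpowers (genX 2 (m + 5))).index = 2 := by
  refine index_eq_two_iff.2 ⟨genY 2 (m + 5), fun b => ?_⟩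
  have hy := genY_notMem m
  have hb : b ∈ closure {genX 2 (m + 5), genY 2 (m + 5)} := by rw [closure_gens]; trivial
  obtain ⟨i, rfl | rfl⟩ := exists_zpow_of_mem_closure_pair (genY_mul_genY m) (genY_conj m) hb
  · have hi : genX 2 (m + 5) ^ i ∈ zpowers (genX 2 (m + 5)) := zpow_mem (mem_zpowers _) i
    exact Or.inr ⟨hi, fun h => hy ((mul_mem_cancel_left hi).1 h)⟩
  · have hi : genX 2 (m + 5) ^ i ∈ zpowers (genX 2 (m + 5)) := zpow_mem (mem_zpowers _) i
    refine Or.inl ⟨?_, fun h => hy ((mul_mem_cancel_left hi).1 h)⟩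
    rwa [mul_assoc, genY_mul_genY, mul_one]

lemma card_eq : Nat.card (ModularGroup 2 (m + 5)) = 2 ^ (m + 5) := by
  rw [← (zpowers (genX 2 (m + 5))).card_mul_index, index_zpowers_genX, Nat.card_zpowers,
    orderOf_genX, ← pow_succ]

instance : Finite (ModularGroup 2 (m + 5)) :=
  Nat.finite_of_card_ne_zero (by rw [card_eq]; positivity)

lemma not_isCyclic : ¬ IsCyclic (ModularGroup 2 (m + 5)) := by
  intro h
  obtain ⟨f, hfx, hfy⟩ := exists_affine_rep m
  have hcomm := congrArg (fun g => f g 0)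
    (IsCyclic.isMulCommutative.is_comm.comm (genY 2 (m + 5)) (genX 2 (m + 5)))
  refine one_add_two_pow_ne_one (m := m) ?_
  simpa [hfx, hfy] using hcomm

lemma card_subgroup : Nat.card (Subgroup (ModularGroup 2 (m + 5))) = 3 * m + 14 := by
  refine le_antisymm ?_
    ((le_card_subgroup_of_not_isCyclic (m + 1) _ (card_eq m) (not_isCyclic m)).trans' (by omega))
  exact (card_subgroup_le_of_closure_pair_eq_top (genY_mul_genY m) (genX_pow 2 (m + 5))
    (genY_conj m) (closure_gens 2 (m + 5))).trans (by omega)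

variable {m} in
lemma nonempty_mulEquiv {G : Type*} [Group G] [Finite G] {a t : G}
    (ha : orderOf a = 2 ^ (m + 4)) (hA : (zpowers a).index = 2) (ht : t ∉ zpowers a)
    (htt : t * t = 1) (hat : t * a * t = a ^ (1 + 2 ^ (m + 3))) :
    Nonempty (G ≃* ModularGroup 2 (m + 5)) := by
  obtain ⟨f, hfx, hfy⟩ := exists_hom (p := 2) (n := m + 5) (a := a) (t := t)
    (orderOf_dvd_iff_pow_eq_one.1 ha.dvd) (by rw [pow_two, htt])
    (by rw [inv_eq_of_mul_eq_one_left htt, hat]; rfl)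
  refine nonempty_mulEquiv_of_range f hA ht ⟨_, hfx⟩ ⟨_, hfy⟩ ?_
  rw [card_eq, ← (zpowers a).card_mul_index, hA, Nat.card_zpowers, ha, pow_succ]

end Two

end ModularGroup

lemma beta_congr {G H : Type*} [Group G] [Group H] (e : G ≃* H) : beta G = beta H := by
  rw [beta, beta, Nat.card_congr e.toEquiv, Nat.card_congr e.mapSubgroup.toEquiv]

theorem stmt_6 (n : ℕ) (hn : 4 < n) (G : Type) [Group G] [Finite G]
    (hcard : Nat.card G = 2 ^ n) (hnc : ¬ IsCyclic G) :
    beta (Multiplicative (ZMod 2) × Multiplicative (ZMod (2 ^ (n - 1))))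
      = (3 * ((n : ℝ) - 1) + 2) / 2 ^ n ∧
    beta (ModularGroup 2 n) = (3 * ((n : ℝ) - 1) + 2) / 2 ^ n ∧
    beta G ≥ (3 * ((n : ℝ) - 1) + 2) / 2 ^ n ∧
    (beta G = (3 * ((n : ℝ) - 1) + 2) / 2 ^ n ↔
      (Nonempty (G ≃* Multiplicative (ZMod 2) × Multiplicative (ZMod (2 ^ (n - 1)))) ∨
       Nonempty (G ≃* ModularGroup 2 n))) := by
  obtain ⟨m, rfl⟩ : ∃ m, n = m + 5 := ⟨n - 5, by omega⟩
  have hval : (3 * (((m + 5 : ℕ) : ℝ) - 1) + 2) = ((3 * m + 14 : ℕ) : ℝ) := by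
    push_cast
    ring
  have hpos : (0 : ℝ) < 2 ^ (m + 5) := by positivity
  rw [hval]
  have : NeZero (2 ^ (m + 4)) := ⟨by positivity⟩
  have hprod : beta (Multiplicative (ZMod 2) × Multiplicative (ZMod (2 ^ (m + 5 - 1)))) =
      ((3 * m + 14 : ℕ) : ℝ) / 2 ^ (m + 5) := by
    have hc : Nat.card (Multiplicative (ZMod 2) × Multiplicative (ZMod (2 ^ (m + 4)))) =
        2 ^ (m + 5) := by
      rw [Nat.card_prod]
      simp
      ring
    change beta (Multiplicative (ZMod 2) × Multiplicative (ZMod (2 ^ (m + 4)))) = _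
    rw [beta, card_subgroup_prod, hc]
    push_cast
    rfl
  have hmod : beta (ModularGroup 2 (m + 5)) = ((3 * m + 14 : ℕ) : ℝ) / 2 ^ (m + 5) := by
    rw [beta, ModularGroup.card_subgroup, ModularGroup.card_eq]
    push_cast
    rfl
  have hG : beta G = (Nat.card (Subgroup G) : ℝ) / 2 ^ (m + 5) := by
    rw [beta, hcard]
    push_cast
    rfl
  refine ⟨hprod, hmod, ?_, fun h => ?_, ?_⟩
  · rw [hG, ge_iff_le, div_le_div_iff_of_pos_right hpos, Nat.cast_le]
    exact (le_card_subgroup_of_not_isCyclic (m + 1) G hcard hnc).trans' (by omega)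
  · rw [hG, div_left_inj' hpos.ne', Nat.cast_inj] at h
    obtain ⟨a, t, ha, hA, ht, htt, hat | hat⟩ :=
      exists_involution_of_card_subgroup_le hcard hnc h.le
    · exact Or.inl (nonempty_mulEquiv_prod ha hA ht htt hat)
    · exact Or.inr (ModularGroup.nonempty_mulEquiv ha hA ht htt hat)
  · rintro (⟨⟨e⟩⟩ | ⟨⟨e⟩⟩)
    · rw [beta_congr e, hprod]
    · rw [beta_congr e, hmod]
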